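/- arXiv:2306.03200 — 2 statements merged into one kernel-verified Lean document; each statement's English description precedes it below -/
import Mathlib

section
/- The number of vectors of norm 2n in the E8 lattice equals 240·σ_3(n) for every positive integer n; i.e., the theta series of E8 is the Eisenstein series E_4(q) = 1 + 240·Σ σ_3(n)q^n. -/
noncomputable section

/-- The standard inner product on ℝ⁸. -/
def dot8 (u v : Fin 8 → ℝ) : ℝ := ∑ i, u i * v i

/-- Membership in the E8 lattice: all coordinates integers or all half-odd-integers,
with even coordinate sum. -/
def inE8 (v : Fin 8 → ℝ) : Prop :=
  ((∀ i, ∃ n : ℤ, v i = (n : ℝ)) ∨ (∀ i, ∃ n : ℤ, v i = (n : ℝ) + 1 / 2)) ∧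
    ∃ m : ℤ, (∑ i, v i) = 2 * (m : ℝ)

namespace E8Theta

open Complex ModularForm EisensteinSeries MatrixGroups
open UpperHalfPlane hiding I
open scoped Real

/-- Powers of an absolutely convergent sum as a sum over tuples. -/
lemma hasSum_pi_prod (f : ℤ → ℂ) (hf : Summable fun n => ‖f n‖) (k : ℕ) :
    (Summable fun v : Fin k → ℤ => ‖∏ i, f (v i)‖) ∧
      HasSum (fun v : Fin k → ℤ => ∏ i, f (v i)) ((∑' n, f n) ^ k) := by
  induction k with
  | zero =>
    refine ⟨(hasSum_fintype _).summable, ?_⟩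
    convert hasSum_fintype (fun v : Fin 0 → ℤ => ∏ i, f (v i)) using 1
    simp
  | succ k ih =>
    obtain ⟨h1, h2⟩ := ih
    have hs : Summable fun x : ℤ × (Fin k → ℤ) => ‖f x.1 * ∏ i, f (x.2 i)‖ :=
      Summable.mul_norm (f := f) (g := fun v : Fin k → ℤ => ∏ i, f (v i)) hf h1
    have ht : HasSum (fun x : ℤ × (Fin k → ℤ) => f x.1 * ∏ i, f (x.2 i))
        ((∑' n, f n) ^ (k + 1)) := by
      have h := tsum_mul_tsum_of_summable_norm (f := f)
        (g := fun v : Fin k → ℤ => ∏ i, f (v i)) hf h1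
      rw [h2.tsum_eq] at h
      rw [pow_succ', h]
      exact hs.of_norm.hasSum
    constructor
    · rw [← (Fin.consEquiv (fun _ : Fin (k + 1) => ℤ)).summable_iff]
      refine hs.congr fun x => ?_
      simp [Fin.consEquiv, Fin.prod_univ_succ]
    · rw [← (Fin.consEquiv (fun _ : Fin (k + 1) => ℤ)).hasSum_iff]
      convert ht using 1
      ext x
      simp [Fin.consEquiv, Fin.prod_univ_succ]

/-- The theta constants. -/
def th3 (τ : ℂ) : ℂ := jacobiTheta₂ 0 τ
def th4 (τ : ℂ) : ℂ := jacobiTheta₂ (1 / 2) τ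
def th2 (τ : ℂ) : ℂ := cexp (π * I * τ / 4) * jacobiTheta₂ (τ / 2) τ

lemma hasSum_th3 {τ : ℂ} (hτ : 0 < τ.im) :
    HasSum (fun n : ℤ => cexp (π * I * τ * (n : ℂ) ^ 2)) (th3 τ) := by
  refine (hasSum_jacobiTheta₂_term 0 hτ).congr_fun ?_
  intro n
  simp only [jacobiTheta₂_term]
  congr 1; ring

lemma hasSum_th4 {τ : ℂ} (hτ : 0 < τ.im) :
    HasSum (fun n : ℤ => cexp (π * I * n) * cexp (π * I * τ * (n : ℂ) ^ 2)) (th4 τ) := by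
  refine (hasSum_jacobiTheta₂_term (1 / 2) hτ).congr_fun ?_
  intro n
  simp only [jacobiTheta₂_term, ← Complex.exp_add]
  congr 1; ring

lemma hasSum_th2 {τ : ℂ} (hτ : 0 < τ.im) :
    HasSum (fun n : ℤ => cexp (π * I * τ * ((n : ℂ) + 1 / 2) ^ 2)) (th2 τ) := by
  refine ((hasSum_jacobiTheta₂_term (τ / 2) hτ).mul_left (cexp (π * I * τ / 4))).congr_fun ?_
  intro n
  simp only [jacobiTheta₂_term, ← Complex.exp_add]
  congr 1; ring

lemma exp_pi_int (n : ℤ) : cexp (π * I * n) = if Even n then 1 else -1 := by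
  split_ifs with h
  · obtain ⟨m, rfl⟩ := h
    rw [Complex.exp_eq_one_iff]
    exact ⟨m, by push_cast; ring⟩
  · obtain ⟨m, rfl⟩ := Int.not_even_iff_odd.mp h
    rw [show (π * I * ((2 * m + 1 : ℤ) : ℂ)) = m * (2 * π * I) + π * I by push_cast; ring,
      Complex.exp_add, Complex.exp_pi_mul_I, Complex.exp_int_mul_two_pi_mul_I]
    ring

lemma hasSum_th1 {τ : ℂ} (hτ : 0 < τ.im) :
    HasSum (fun n : ℤ => cexp (π * I * n) * cexp (π * I * τ * ((n : ℂ) + 1 / 2) ^ 2)) 0 := by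
  have hs : Summable (fun n : ℤ =>
      cexp (π * I * n) * cexp (π * I * τ * ((n : ℂ) + 1 / 2) ^ 2)) := by
    refine Summable.of_norm ((hasSum_th2 hτ).summable.norm.congr fun n => ?_)
    rw [norm_mul, exp_pi_int]
    split_ifs <;> simp
  obtain ⟨a, ha⟩ := hs
  have h2 := ((Equiv.subLeft (-1 : ℤ)).hasSum_iff.mpr ha)
  have h3 : HasSum (fun n : ℤ =>
      -(cexp (π * I * n) * cexp (π * I * τ * ((n : ℂ) + 1 / 2) ^ 2))) a := by
    refine h2.congr_fun ?_
    intro n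
    simp only [Function.comp, Equiv.subLeft_apply, exp_pi_int]
    have : Even (-1 - n) ↔ ¬ Even n := by
      rw [Int.even_sub]; simp
    rw [show ((((-1 - n : ℤ) : ℂ)) + 1 / 2) ^ 2 = ((n : ℂ) + 1 / 2) ^ 2 by push_cast; ring]
    by_cases h : Even n <;> simp [this, h]
  have h4 := ha.neg.unique h3
  have : a = 0 := by linear_combination (-1 / 2) * h4
  rwa [this] at ha

def thE (τ : ℂ) : ℂ := (th3 τ ^ 8 + th4 τ ^ 8 + th2 τ ^ 8) / 2

lemma cpow_half_pow (x : ℂ) : (x ^ (1 / 2 : ℂ)) ^ 8 = x ^ 4 := by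
  rw [← Complex.cpow_nat_mul]
  norm_num

lemma thE_S {τ : ℂ} (hτ : 0 < τ.im) : thE (-1 / τ) = τ ^ 4 * thE τ := by
  have h0 : τ ≠ 0 := by rintro rfl; simp at hτ
  set c : ℂ := (-I * τ) ^ (1 / 2 : ℂ) with hc
  have hc8 : c ^ 8 = τ ^ 4 := by
    rw [hc, cpow_half_pow, mul_pow, Even.neg_pow (by decide), Complex.I_pow_four, one_mul]
  have hc0 : c ≠ 0 := by
    intro h
    rw [h] at hc8
    exact pow_ne_zero 4 h0 (by simpa using hc8.symm)
  have e3 : th3 (-1 / τ) = c * th3 τ := by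
    have := jacobiTheta₂_functional_equation 0 τ
    rw [← hc] at this
    unfold th3
    rw [this]
    simp
    field_simp
  have e2 : th2 (-1 / τ) = c * th4 τ := by
    have := jacobiTheta₂_functional_equation (1 / 2) τ
    rw [← hc] at this
    unfold th2 th4
    rw [this, show (-1 / τ / 2) = -(1 / 2 / τ) by ring, jacobiTheta₂_neg_left,
      show π * I * (-1 / τ) / 4 = -π * I * (1 / 2) ^ 2 / τ by ring]
    field_simp
  have e4 : th4 (-1 / τ) = c * th2 τ := by
    have := jacobiTheta₂_functional_equation (τ / 2) τ
    rw [← hc] at this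
    unfold th2 th4
    rw [this, show τ / 2 / τ = 1 / 2 by field_simp,
      show -π * I * (τ / 2) ^ 2 / τ = -(π * I * τ / 4) by field_simp; ring, Complex.exp_neg]
    have := Complex.exp_ne_zero (π * I * τ / 4)
    field_simp
  unfold thE
  rw [e2, e3, e4, mul_pow, mul_pow, mul_pow, hc8]
  ring

lemma differentiableAt_thE {τ : ℂ} (hτ : 0 < τ.im) : DifferentiableAt ℂ thE τ := by
  have h3 : DifferentiableAt ℂ th3 τ := differentiableAt_jacobiTheta₂_snd 0 hτ
  have h4 : DifferentiableAt ℂ th4 τ := differentiableAt_jacobiTheta₂_snd _ hτ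
  have h2 : DifferentiableAt ℂ th2 τ := by
    unfold th2
    refine DifferentiableAt.mul (by fun_prop) ?_
    have hp : DifferentiableAt ℂ (fun t : ℂ => (t / 2, t)) τ := by fun_prop
    exact DifferentiableAt.comp (f := fun t : ℂ => (t / 2, t)) τ
      (hasFDerivAt_jacobiTheta₂ (τ / 2) hτ).differentiableAt hp
  unfold thE
  fun_prop


/-- Embeddings of integer tuples. -/
def emb0 (v : Fin 8 → ℤ) : Fin 8 → ℝ := fun i => (v i : ℝ)
def emb1 (v : Fin 8 → ℤ) : Fin 8 → ℝ := fun i => (v i : ℝ) + 1 / 2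

lemma emb0_inj : Function.Injective emb0 := by
  intro v w h
  ext i
  have := congrFun h i
  simpa [emb0] using this

lemma emb1_inj : Function.Injective emb1 := by
  intro v w h
  ext i
  have := congrFun h i
  simpa [emb1] using this

lemma not_both (v w : Fin 8 → ℤ) : emb0 v ≠ emb1 w := by
  intro h
  have := congrFun h 0
  simp only [emb0, emb1] at this
  have h2 : (2 * v 0 : ℤ) = 2 * w 0 + 1 := by
    have : (2 * v 0 : ℝ) = 2 * w 0 + 1 := by rw [this]; ring
    exact_mod_cast this
  omega

lemma inE8_emb0 (v : Fin 8 → ℤ) (h : Even (∑ i, v i)) : inE8 (emb0 v) := by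
  refine ⟨Or.inl fun i => ⟨v i, rfl⟩, ?_⟩
  obtain ⟨m, hm⟩ := h
  refine ⟨m, ?_⟩
  simp only [emb0]
  rw [← Int.cast_sum, hm]
  push_cast; ring

lemma inE8_emb1 (v : Fin 8 → ℤ) (h : Even (∑ i, v i)) : inE8 (emb1 v) := by
  refine ⟨Or.inr fun i => ⟨v i, rfl⟩, ?_⟩
  obtain ⟨m, hm⟩ := h
  refine ⟨m + 2, ?_⟩
  simp only [emb1]
  rw [Finset.sum_add_distrib, ← Int.cast_sum, hm]
  simp
  ring

lemma inE8_cases {x : Fin 8 → ℝ} (h : inE8 x) :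
    ∃ v : Fin 8 → ℤ, Even (∑ i, v i) ∧ (x = emb0 v ∨ x = emb1 v) := by
  obtain ⟨h | h, m, hm⟩ := h
  · choose v hv using h
    refine ⟨v, ⟨m, ?_⟩, Or.inl (funext hv)⟩
    simp only [hv] at hm
    have : (∑ i, v i : ℤ) = 2 * m := by exact_mod_cast hm
    omega
  · choose v hv using h
    refine ⟨v, ⟨m - 2, ?_⟩, Or.inr (funext hv)⟩
    simp only [hv, Finset.sum_add_distrib] at hm
    have : ((∑ i, v i : ℤ) : ℝ) = 2 * m - 4 := by
      push_cast
      simp at hm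
      linarith
    have : (∑ i, v i : ℤ) = 2 * m - 4 := by exact_mod_cast this
    omega

lemma even_sum_mul_succ (v : Fin 8 → ℤ) : Even (∑ i, (v i * v i + v i)) := by
  refine Finset.even_sum _ fun i _ => ?_
  have := Int.even_mul_succ_self (v i)
  rwa [mul_add, mul_one] at this

lemma exists_norm {x : Fin 8 → ℝ} (h : inE8 x) : ∃ n : ℕ, dot8 x x = 2 * (n : ℝ) := by
  suffices hz : ∃ n : ℤ, dot8 x x = 2 * (n : ℝ) by
    obtain ⟨n, hn⟩ := hz
    have h0 : 0 ≤ dot8 x x := Finset.sum_nonneg fun i _ => mul_self_nonneg _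
    have : (0 : ℝ) ≤ (n : ℝ) := by linarith
    lift n to ℕ using (by exact_mod_cast this)
    exact ⟨n, by simpa using hn⟩
  obtain ⟨v, hv, rfl | rfl⟩ := inE8_cases h
  · have h2 := even_sum_mul_succ v
    rw [Finset.sum_add_distrib] at h2
    obtain ⟨m, hm⟩ := (Int.even_add.mp h2).mpr hv
    refine ⟨m, ?_⟩
    have : ((∑ i, v i * v i : ℤ) : ℝ) = ((m + m : ℤ) : ℝ) := by rw [hm]
    push_cast at this
    simp only [dot8, emb0]
    rw [this]; ring
  · obtain ⟨m, hm⟩ := even_sum_mul_succ v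
    refine ⟨m + 1, ?_⟩
    have h3 : ((∑ i, (v i * v i + v i) : ℤ) : ℝ) = ((m + m : ℤ) : ℝ) := by rw [hm]
    push_cast at h3
    have : dot8 (emb1 v) (emb1 v) = ∑ i, (((v i : ℝ) * v i + v i) + 1 / 4) :=
      Finset.sum_congr rfl fun i _ => by simp only [emb1]; ring
    rw [this, Finset.sum_add_distrib, h3]
    push_cast
    simp
    ring

/-- Gaussian weight of a vector. -/
def gw (τ : ℂ) (x : Fin 8 → ℝ) : ℂ := cexp (π * I * τ * (dot8 x x : ℝ))

lemma hasSum_emb0 {τ : ℂ} (hτ : 0 < τ.im) :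
    HasSum (fun v : Fin 8 → ℤ => if Even (∑ i, v i) then gw τ (emb0 v) else 0)
      ((th3 τ ^ 8 + th4 τ ^ 8) / 2) := by
  have h3 := (hasSum_pi_prod _ (hasSum_th3 hτ).summable.norm 8).2
  have h4 := (hasSum_pi_prod _ (hasSum_th4 hτ).summable.norm 8).2
  rw [(hasSum_th3 hτ).tsum_eq] at h3
  rw [(hasSum_th4 hτ).tsum_eq] at h4
  refine ((h3.add h4).div_const 2).congr_fun fun v => ?_
  have e : ∏ i, cexp (π * I * τ * (v i : ℂ) ^ 2) = gw τ (emb0 v) := by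
    rw [← Complex.exp_sum, gw]
    congr 1
    simp only [dot8, emb0]
    push_cast
    rw [Finset.mul_sum]
    exact Finset.sum_congr rfl fun i _ => by ring
  have e2 : ∏ i, cexp (π * I * (v i : ℂ)) = cexp (π * I * ((∑ i, v i : ℤ) : ℂ)) := by
    rw [← Complex.exp_sum]
    push_cast
    rw [Finset.mul_sum]
  rw [Finset.prod_mul_distrib, e, e2, exp_pi_int]
  split_ifs <;> ring

lemma hasSum_emb1 {τ : ℂ} (hτ : 0 < τ.im) :
    HasSum (fun v : Fin 8 → ℤ => if Even (∑ i, v i) then gw τ (emb1 v) else 0)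
      (th2 τ ^ 8 / 2) := by
  have h3 := (hasSum_pi_prod _ (hasSum_th2 hτ).summable.norm 8).2
  have h4 := (hasSum_pi_prod _ (hasSum_th1 hτ).summable.norm 8).2
  rw [(hasSum_th2 hτ).tsum_eq] at h3
  rw [(hasSum_th1 hτ).tsum_eq] at h4
  have h5 := (h3.add h4).div_const 2
  rw [show (th2 τ ^ 8 + 0 ^ 8) / 2 = th2 τ ^ 8 / 2 by ring] at h5
  refine h5.congr_fun fun v => ?_
  have e : ∏ i, cexp (π * I * τ * ((v i : ℂ) + 1 / 2) ^ 2) = gw τ (emb1 v) := by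
    rw [← Complex.exp_sum, gw]
    congr 1
    simp only [dot8, emb1]
    push_cast
    rw [Finset.mul_sum]
    exact Finset.sum_congr rfl fun i _ => by ring
  have e2 : ∏ i, cexp (π * I * (v i : ℂ)) = cexp (π * I * ((∑ i, v i : ℤ) : ℂ)) := by
    rw [← Complex.exp_sum]
    push_cast
    rw [Finset.mul_sum]
  rw [Finset.prod_mul_distrib, e, e2, exp_pi_int]
  split_ifs <;> ring

lemma hasSum_E8 {τ : ℂ} (hτ : 0 < τ.im) :
    HasSum (fun x : {x // inE8 x} => gw τ x) (thE τ) := by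
  classical
  let S0 : Set (Fin 8 → ℝ) := {x | ∃ v : Fin 8 → ℤ, Even (∑ i, v i) ∧ x = emb0 v}
  let S1 : Set (Fin 8 → ℝ) := {x | ∃ v : Fin 8 → ℤ, Even (∑ i, v i) ∧ x = emb1 v}
  have h0 : HasSum (S0.indicator (gw τ)) ((th3 τ ^ 8 + th4 τ ^ 8) / 2) := by
    rw [← emb0_inj.hasSum_iff]
    · refine (hasSum_emb0 hτ).congr_fun fun v => ?_
      have : emb0 v ∈ S0 ↔ Even (∑ i, v i) :=
        ⟨fun ⟨w, hw, e⟩ => by rwa [emb0_inj e], fun h => ⟨v, h, rfl⟩⟩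
      simp only [Function.comp, Set.indicator_apply, this]
    · rintro x hx
      refine Set.indicator_of_notMem ?_ _
      rintro ⟨v, _, rfl⟩
      exact hx ⟨v, rfl⟩
  have h1 : HasSum (S1.indicator (gw τ)) (th2 τ ^ 8 / 2) := by
    rw [← emb1_inj.hasSum_iff]
    · refine (hasSum_emb1 hτ).congr_fun fun v => ?_
      have : emb1 v ∈ S1 ↔ Even (∑ i, v i) :=
        ⟨fun ⟨w, hw, e⟩ => by rwa [emb1_inj e], fun h => ⟨v, h, rfl⟩⟩
      simp only [Function.comp, Set.indicator_apply, this]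
    · rintro x hx
      refine Set.indicator_of_notMem ?_ _
      rintro ⟨v, _, rfl⟩
      exact hx ⟨v, rfl⟩
  have hd : Disjoint S0 S1 := by
    rw [Set.disjoint_left]
    rintro x ⟨v, _, rfl⟩ ⟨w, _, e⟩
    exact not_both v w e
  have hu : S0 ∪ S1 = {x | inE8 x} := by
    ext x
    constructor
    · rintro (⟨v, hv, rfl⟩ | ⟨v, hv, rfl⟩)
      · exact inE8_emb0 v hv
      · exact inE8_emb1 v hv
    · intro h
      obtain ⟨v, hv, e | e⟩ := inE8_cases h
      · exact Or.inl ⟨v, hv, e⟩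
      · exact Or.inr ⟨v, hv, e⟩
  have h := h0.add h1
  rw [show (th3 τ ^ 8 + th4 τ ^ 8) / 2 + th2 τ ^ 8 / 2 = thE τ by unfold thE; ring] at h
  have h' : HasSum ({x | inE8 x}.indicator (gw τ)) (thE τ) := by
    rw [← hu, Set.indicator_union_of_disjoint hd]
    exact h
  exact hasSum_subtype_iff_indicator.mpr h'

/-- The representation numbers. -/
def rep (n : ℕ) : ℕ := Set.ncard {v : Fin 8 → ℝ | inE8 v ∧ dot8 v v = 2 * (n : ℝ)}

lemma hasSum_rep (τ : ℍ) :
    HasSum (fun m : ℕ => (rep m : ℂ) • Function.Periodic.qParam (1 : ℝ) τ ^ m) (thE τ) := by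
  choose N hN using fun x : {x // inE8 x} => exists_norm x.2
  set q := Function.Periodic.qParam (1 : ℝ) (τ : ℂ) with hq
  have hg : ∀ x : {x // inE8 x}, gw τ x = q ^ N x := by
    intro x
    rw [gw, hN x, hq, Function.Periodic.qParam, ← Complex.exp_nat_mul]
    congr 1
    push_cast
    ring
  have h := hasSum_E8 τ.im_pos
  simp only [hg] at h
  rw [← (Equiv.sigmaFiberEquiv N).hasSum_iff] at h
  refine h.sigma fun m => ?_
  have hs := (h.summable.sigma_factor m).hasSum
  have hc : ∀ c : {x // N x = m}, ((fun x => q ^ N x) ∘ (Equiv.sigmaFiberEquiv N)) ⟨m, c⟩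
      = q ^ m := by
    rintro ⟨c, hc⟩
    simp [Equiv.sigmaFiberEquiv, hc]
  simp only [hc] at hs ⊢
  rw [tsum_const] at hs
  have : rep m = Nat.card {x // N x = m} := by
    rw [rep, ← Nat.card_coe_set_eq]
    refine Nat.card_congr ⟨fun v => ⟨⟨v.1, v.2.1⟩, ?_⟩, fun x => ⟨x.1.1, x.1.2, ?_⟩, ?_, ?_⟩
    · have h1 := hN ⟨v.1, v.2.1⟩
      have h2 := v.2.2
      have : (N ⟨v.1, v.2.1⟩ : ℝ) = m := by
        simp only at h1
        linarith
      exact_mod_cast this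
    · rw [hN x.1, x.2]
    · intro v; rfl
    · intro v; rfl
  rw [this, smul_eq_mul, ← nsmul_eq_mul]
  exact hs

lemma rep_zero : rep 0 = 1 := by
  rw [rep, Set.ncard_eq_one]
  refine ⟨0, ?_⟩
  ext v
  simp only [Set.mem_ofPred_eq, Set.mem_singleton_iff]
  constructor
  · rintro ⟨_, h⟩
    simp only [dot8, Nat.cast_zero, mul_zero] at h
    rw [Finset.sum_eq_zero_iff_of_nonneg (fun i _ => mul_self_nonneg _)] at h
    ext i
    simpa using h i (Finset.mem_univ i)
  · rintro rfl
    exact ⟨⟨Or.inl fun i => ⟨0, by simp⟩, 0, by simp⟩, by simp [dot8]⟩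

/-- The theta series as a function on the upper half plane. -/
def thH (τ : ℍ) : ℂ := thE τ

lemma thH_S : thH ∣[(4 : ℤ)] ModularGroup.S = thH := by
  ext τ
  rw [SL_slash_apply, UpperHalfPlane.modular_S_smul, ModularGroup.denom_S]
  have h0 : (τ : ℂ) ≠ 0 := UpperHalfPlane.ne_zero τ
  have := thE_S τ.im_pos
  unfold thH
  simp only
  rw [show ((-τ : ℂ))⁻¹ = -1 / τ by rw [inv_neg, neg_div, one_div], this, zpow_neg]
  norm_cast
  field_simp

lemma thH_T : thH ∣[(4 : ℤ)] ModularGroup.T = thH := by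
  ext τ
  have hd : denom ModularGroup.T τ = 1 := by
    have h := ModularGroup.denom_apply ModularGroup.T τ
    have h0 : ModularGroup.T 1 0 = 0 := rfl
    have h1 : ModularGroup.T 1 1 = 1 := rfl
    rw [h0, h1] at h
    rw [h]
    simp
  rw [SL_slash_apply, UpperHalfPlane.modular_T_smul, hd, one_zpow, mul_one]
  refine (hasSum_rep _).unique ?_
  change HasSum _ (thE τ)
  convert hasSum_rep τ using 4
  rw [UpperHalfPlane.coe_vadd, add_comm]
  simp only [Function.Periodic.qParam]
  rw [show 2 * π * I * ((τ : ℂ) + ((1 : ℝ) : ℂ)) / ((1 : ℝ) : ℂ)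
    = 2 * π * I * (τ : ℂ) / ((1 : ℝ) : ℂ) + 2 * π * I by push_cast; ring]
  exact Complex.exp_periodic _

lemma thH_slash (γ : SL(2, ℤ)) : thH ∣[(4 : ℤ)] γ = thH :=
  SlashInvariantForm.slash_action_generators_SL2Z thH_S thH_T γ

/-- The theta series as a modular form. -/
def thM : ModularForm 𝒮ℒ 4 where
  toFun := thH
  slash_action_eq' := fun _ ⟨γ, hγ⟩ => hγ ▸ thH_slash γ
  holo' := by
    refine UpperHalfPlane.mdifferentiable_iff.mpr fun z hz => ?_
    refine DifferentiableAt.differentiableWithinAt ?_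
    refine (differentiableAt_thE hz).congr_of_eventuallyEq ?_
    filter_upwards [isOpen_upperHalfPlaneSet.mem_nhds hz] with w hw
    simp [thH, UpperHalfPlane.ofComplex_apply_of_im_pos hw]
  bdd_at_cusps' {c} hc := by
    rw [Subgroup.IsArithmetic.isCusp_iff_isCusp_SL2Z] at hc
    rw [OnePoint.isBoundedAt_iff_forall_SL2Z hc]
    intro γ _
    rw [thH_slash γ]
    exact isBoundedAtImInfty_of_hasSum_qExpansion one_pos hasSum_rep

lemma coeff_thM (m : ℕ) : (qExpansion 1 thM).coeff m = (rep m : ℂ) :=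
  (ModularFormClass.qExpansion_coeff_unique one_pos one_mem_strictPeriods_SL
    (f := thM) (c := fun m => (rep m : ℂ)) hasSum_rep m).symm

lemma rep_eq (n : ℕ) (hn : 0 < n) : rep n = 240 * ∑ d ∈ n.divisors, d ^ 3 := by
  obtain ⟨c, hc⟩ : ∃ c : ℂ, c • E₄ = thM :=
    (finrank_eq_one_iff_of_nonzero' E₄ (E_ne_zero _ ⟨2, rfl⟩)).mp
      (Module.rank_eq_one_iff_finrank_eq_one.mp levelOne_weight_four_rank_one) _
  have key : ∀ m, c * (qExpansion 1 E₄).coeff m = (rep m : ℂ) := by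
    intro m
    rw [← coeff_thM, ← hc]
    have := ModularForm.qExpansion_smul one_pos one_mem_strictPeriods_SL c E₄
    rw [FunLike.coe_smul, this]
    simp
  have hc1 : c = 1 := by
    have := key 0
    rw [rep_zero, E_qExpansion_coeff_zero _ ⟨2, rfl⟩] at this
    simpa using this
  have h := key n
  rw [hc1, E_qExpansion_coeff _ ⟨2, rfl⟩, if_neg hn.ne',
    show bernoulli 4 = -1 / 30 by decide +kernel, ArithmeticFunction.sigma_apply] at h
  norm_num at h
  exact_mod_cast h.symm

end E8Theta

/-- The theta series of E8 is E₄: the number of vectors of norm 2n in E8 is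
240·σ₃(n) for every n > 0. -/
theorem e8_theta_is_E4 (n : ℕ) (hn : 0 < n) :
    Set.ncard {v : Fin 8 → ℝ | inE8 v ∧ dot8 v v = 2 * (n : ℝ)} =
      240 * ∑ d ∈ n.divisors, d ^ 3 :=
  E8Theta.rep_eq n hn
end
end

section
/- For a rational elliptic surface R with all fibers irreducible, the set of divisor classes of arithmetic-genus-g height-g bisections is in bijection, via the orthogonal projection Π to ZF^⊥(R) ≅ E8(−1), with the vectors of norm −2(g+2) in E8(−1); in particular its cardinality is 240·σ_3(g+2). -/
noncomputable section

namespace E8Theta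

open Complex Real

theorem hasSum_pow_aux (f : ℤ → ℂ) (hf : Summable fun n => ‖f n‖) (k : ℕ) :
    (Summable fun n : Fin k → ℤ => ‖∏ i, f (n i)‖) ∧
      HasSum (fun n : Fin k → ℤ => ∏ i, f (n i)) ((∑' n, f n) ^ k) := by
  induction k with
  | zero =>
    refine ⟨(hasSum_unique _).summable, ?_⟩
    simp
  | succ k ih =>
    obtain ⟨h1, h2⟩ := ih
    have hs : Summable fun p : ℤ × (Fin k → ℤ) => ‖f p.1 * ∏ i, f (p.2 i)‖ := Summable.mul_norm (f := f) (g := fun n : Fin k → ℤ => ∏ i, f (n i)) hf h1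
    constructor
    · rw [← (Fin.consEquiv (fun _ : Fin (k + 1) => ℤ)).summable_iff]
      refine hs.congr fun p => ?_
      simp [Fin.prod_univ_succ, Fin.consEquiv]
    · rw [← (Fin.consEquiv (fun _ : Fin (k + 1) => ℤ)).hasSum_iff]
      have h3 := hs.of_norm.hasSum
      rw [← tsum_mul_tsum_of_summable_norm hf h1, h2.tsum_eq, ← pow_succ'] at h3
      convert! h3 using 1
      ext p
      simp [Fin.prod_univ_succ, Fin.consEquiv]

/-- The three theta constants (eighth powers) summed. -/
def thetaB (τ : ℂ) : ℂ := cexp (2 * π * I * τ) * jacobiTheta₂ (τ / 2) τ ^ 8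

def thetaE8 (τ : ℂ) : ℂ :=
  (jacobiTheta₂ 0 τ ^ 8 + jacobiTheta₂ (1 / 2) τ ^ 8 + thetaB τ) / 2

theorem exp_int_parity (n : ℤ) (h : Even n) : cexp (π * I * n) = 1 := by
  obtain ⟨m, rfl⟩ := h
  rw [← Complex.exp_int_mul_two_pi_mul_I m]
  congr 1; push_cast; ring

theorem exp_congr_parity (n : ℤ) (h : Even n) {a b : ℂ} (hab : a = b + π * I * n) :
    cexp a = cexp b := by
  rw [hab, Complex.exp_add, exp_int_parity n h, mul_one]

theorem theta_zero_add_one (τ : ℂ) : jacobiTheta₂ 0 (τ + 1) = jacobiTheta₂ (1 / 2) τ := by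
  refine tsum_congr fun n => ?_
  refine exp_congr_parity (n ^ 2 - n) (by
    rw [sq, ← mul_sub_one]; exact Int.even_mul_pred_self n) ?_
  push_cast; ring

theorem theta_half_add_one (τ : ℂ) : jacobiTheta₂ (1 / 2) (τ + 1) = jacobiTheta₂ 0 τ := by
  refine tsum_congr fun n => ?_
  refine exp_congr_parity (n ^ 2 + n) (by
    rw [sq, ← mul_add_one]; exact Int.even_mul_succ_self n) ?_
  push_cast; ring

theorem thetaB_add_one (τ : ℂ) : thetaB (τ + 1) = thetaB τ := by
  have h1 : cexp (2 * π * I * (τ + 1)) = cexp (2 * π * I * τ) := by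
    rw [mul_add, mul_one, Complex.exp_add, Complex.exp_two_pi_mul_I, mul_one]
  have h2 : jacobiTheta₂ ((τ + 1) / 2) (τ + 1) = jacobiTheta₂ (τ / 2) τ := by
    refine tsum_congr fun n => ?_
    refine exp_congr_parity (n ^ 2 + n) (by
      rw [sq, ← mul_add_one]; exact Int.even_mul_succ_self n) ?_
    push_cast; ring
  rw [thetaB, h1, h2, thetaB]

theorem thetaE8_add_one (τ : ℂ) : thetaE8 (τ + 1) = thetaE8 τ := by
  rw [thetaE8, theta_zero_add_one, theta_half_add_one, thetaB_add_one, thetaE8]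
  ring

theorem pow_eight_functional (z τ : ℂ) : jacobiTheta₂ z τ ^ 8 =
    (τ ^ 4)⁻¹ * cexp (-8 * π * I * z ^ 2 / τ) * jacobiTheta₂ (z / τ) (-1 / τ) ^ 8 := by
  rw [jacobiTheta₂_functional_equation z τ, mul_pow, mul_pow, ← Complex.exp_nat_mul, div_pow,
    one_pow, ← Complex.cpow_nat_mul]
  have : ((8 : ℕ) : ℂ) * (1 / 2) = (4 : ℕ) := by norm_num
  rw [this, Complex.cpow_natCast, mul_pow]
  have hI : (-I) ^ 4 = 1 := by rw [neg_pow, I_pow_four]; norm_num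
  rw [hI, one_mul, one_div]
  congr 3
  push_cast; ring

theorem thetaB_S {τ : ℂ} (hτ : τ ≠ 0) : thetaB (-1 / τ) = τ ^ 4 * jacobiTheta₂ (1 / 2) τ ^ 8 := by
  rw [pow_eight_functional (1 / 2) τ, thetaB, ← jacobiTheta₂_neg_left (-1 / τ / 2)]
  have h1 : -(-1 / τ / 2) = 1 / 2 / τ := by ring
  have h2 : 2 * π * I * (-1 / τ) = -8 * π * I * (1 / 2) ^ 2 / τ := by ring
  rw [h1, h2]
  field_simp

theorem theta_half_S {τ : ℂ} (hτ : τ ≠ 0) :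
    jacobiTheta₂ (1 / 2) (-1 / τ) ^ 8 = τ ^ 4 * thetaB τ := by
  have h0 : (-1 / τ) ≠ 0 := by simpa using hτ
  have h := thetaB_S h0
  have h1 : -1 / (-1 / τ) = τ := by field_simp
  rw [h1] at h
  rw [h]
  field_simp

theorem theta_zero_S {τ : ℂ} (hτ : τ ≠ 0) :
    jacobiTheta₂ 0 (-1 / τ) ^ 8 = τ ^ 4 * jacobiTheta₂ 0 τ ^ 8 := by
  rw [pow_eight_functional 0 τ]
  simp
  field_simp

theorem thetaE8_S {τ : ℂ} (hτ : τ ≠ 0) : thetaE8 (-1 / τ) = τ ^ 4 * thetaE8 τ := by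
  rw [thetaE8, theta_zero_S hτ, theta_half_S hτ, thetaB_S hτ, thetaE8]
  ring

theorem theta_odd (τ : ℂ) : jacobiTheta₂ ((τ + 1) / 2) τ = 0 := by
  have h := jacobiTheta₂_add_left' ((1 - τ) / 2) τ
  have h1 : (1 - τ) / 2 + τ = (τ + 1) / 2 := by ring
  have h2 : -π * I * (τ + 2 * ((1 - τ) / 2)) = -(π * I) := by ring
  rw [h1, h2, Complex.exp_neg, Complex.exp_pi_mul_I, ← jacobiTheta₂_neg_left ((1 - τ) / 2),
    ← jacobiTheta₂_add_left (-((1 - τ) / 2))] at h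
  have h3 : -((1 - τ) / 2) + 1 = (τ + 1) / 2 := by ring
  rw [h3] at h
  have h4 : (2 : ℂ) * jacobiTheta₂ ((τ + 1) / 2) τ = 0 := by linear_combination h
  simpa using h4

theorem differentiableAt_thetaE8 {τ : ℂ} (hτ : 0 < τ.im) : DifferentiableAt ℂ thetaE8 τ := by
  have h1 := differentiableAt_jacobiTheta₂_snd 0 hτ
  have h2 := differentiableAt_jacobiTheta₂_snd (1 / 2) hτ
  have h3 : DifferentiableAt ℂ (fun τ => jacobiTheta₂ (τ / 2) τ) τ := by
    have hf := (hasFDerivAt_jacobiTheta₂ (τ / 2) hτ).differentiableAt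
    have hg : DifferentiableAt ℂ (fun τ : ℂ => (τ / 2, τ)) τ := by fun_prop
    exact DifferentiableAt.comp (g := fun p : ℂ × ℂ ↦ jacobiTheta₂ p.1 p.2)
      (f := fun τ : ℂ => (τ / 2, τ)) τ hf hg
  unfold thetaE8 thetaB
  fun_prop

theorem prod_term (n : Fin 8 → ℤ) (z τ : ℂ) : ∏ i, jacobiTheta₂_term (n i) z τ =
    cexp (2 * π * I * (∑ i, n i : ℤ) * z + π * I * (∑ i, (n i) ^ 2 : ℤ) * τ) := by
  simp only [jacobiTheta₂_term]
  rw [← Complex.exp_sum, Finset.sum_add_distrib]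
  push_cast
  simp only [Finset.mul_sum, Finset.sum_mul]

/-- Integer vectors with even coordinate sum. -/
abbrev EvenVec : Type := {n : Fin 8 → ℤ // Even (∑ i, n i)}

theorem half_sum (z : ℂ) {τ : ℂ} (hτ : 0 < τ.im) :
    HasSum (fun n : EvenVec =>
      cexp (2 * π * I * (∑ i, n.1 i : ℤ) * z + π * I * (∑ i, (n.1 i) ^ 2 : ℤ) * τ))
      ((jacobiTheta₂ z τ ^ 8 + jacobiTheta₂ (z + 1 / 2) τ ^ 8) / 2) := by
  have h1 := (hasSum_pow_aux _ ((summable_jacobiTheta₂_term_iff z τ).mpr hτ).norm 8).2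
  have h2 := (hasSum_pow_aux _ ((summable_jacobiTheta₂_term_iff (z + 1 / 2) τ).mpr hτ).norm 8).2
  have h3 := (h1.add h2).div_const 2
  have key : ∀ n : Fin 8 → ℤ, (∏ i, jacobiTheta₂_term (n i) z τ +
      ∏ i, jacobiTheta₂_term (n i) (z + 1 / 2) τ) / 2 = if Even (∑ i, n i) then
      cexp (2 * π * I * (∑ i, n i : ℤ) * z + π * I * (∑ i, (n i) ^ 2 : ℤ) * τ) else 0 := by
    intro n
    rw [prod_term, prod_term]
    generalize (∑ i, n i) = s
    generalize (∑ i, (n i) ^ 2) = t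
    split_ifs with h
    · rw [exp_congr_parity s h (a := 2 * π * I * s * (z + 1 / 2) + π * I * t * τ)
        (b := 2 * π * I * s * z + π * I * t * τ) (by ring)]
      ring
    · have h' : Even (s - 1) := by
        rw [Int.not_even_iff_odd] at h; exact h.sub_odd odd_one
      rw [exp_congr_parity (s - 1) h' (a := 2 * π * I * s * (z + 1 / 2) + π * I * t * τ)
        (b := (2 * π * I * s * z + π * I * t * τ) + π * I)
        (by push_cast; ring), Complex.exp_add _ (π * I), Complex.exp_pi_mul_I]
      ring
  simp only [key] at h3
  have h4 := (hasSum_subtype_iff_of_support_subset (s := {n : Fin 8 → ℤ | Even (∑ i, n i)}) (by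
    intro n hn
    by_contra hc
    exact hn (if_neg hc))).mpr h3
  convert! h4 using 1
  ext n
  exact (if_pos n.2).symm

/-- The parametrization of E8. -/
def emb : EvenVec ⊕ EvenVec → (Fin 8 → ℝ)
  | .inl n => fun i => n.1 i
  | .inr n => fun i => n.1 i + 1 / 2

theorem emb_injective : Function.Injective emb := by
  have half : ∀ a b : ℤ, (a : ℝ) ≠ (b : ℝ) + 1 / 2 := by
    intro a b h
    have : (2 * a : ℝ) = 2 * b + 1 := by linarith
    have : 2 * a = 2 * b + 1 := by exact_mod_cast this
    omega
  rintro (n | n) (m | m) h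
  · congr 1; ext i; simpa [emb] using congrFun h i
  · exact (half _ _ (congrFun h 0)).elim
  · exact (half _ _ (congrFun h 0).symm).elim
  · congr 1; ext i; simpa [emb] using congrFun h i

theorem range_emb (v : Fin 8 → ℝ) : inE8 v ↔ v ∈ Set.range emb := by
  constructor
  · rintro ⟨h | h, m, hm⟩
    · choose n hn using h
      refine ⟨.inl ⟨n, m, ?_⟩, ?_⟩
      · simp only [hn] at hm
        rw [← two_mul]; exact_mod_cast hm
      · ext i; simp [emb, hn]
    · choose n hn using h
      refine ⟨.inr ⟨n, m - 2, ?_⟩, ?_⟩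
      · simp only [hn, Finset.sum_add_distrib] at hm
        have : ((∑ i, n i : ℤ) : ℝ) = ((m - 2 + (m - 2) : ℤ) : ℝ) := by
          push_cast; norm_num at hm; linarith
        exact_mod_cast this
      · ext i; simp [emb, hn]
  · rintro ⟨(⟨n, m, hm⟩ | ⟨n, m, hm⟩), rfl⟩
    · refine ⟨.inl fun i => ⟨n i, rfl⟩, m, ?_⟩
      simp only [emb]
      rw [two_mul]; exact_mod_cast hm
    · refine ⟨.inr fun i => ⟨n i, rfl⟩, m + 2, ?_⟩
      have : ((∑ i, n i : ℤ) : ℝ) = ((m + m : ℤ) : ℝ) := by rw [hm]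
      push_cast at this
      simp only [emb, Finset.sum_add_distrib]
      rw [this]; norm_num; ring

theorem exists_norm_s17 (j : EvenVec ⊕ EvenVec) :
    ∃ N : ℕ, dot8 (emb j) (emb j) = 2 * (N : ℝ) := by
  have hpos : 0 ≤ dot8 (emb j) (emb j) := Finset.sum_nonneg fun i _ => mul_self_nonneg _
  suffices h : ∃ k : ℤ, dot8 (emb j) (emb j) = 2 * (k : ℝ) by
    obtain ⟨k, hk⟩ := h
    have : 0 ≤ k := by
      have : (0 : ℝ) ≤ k := by linarith
      exact_mod_cast this
    lift k to ℕ using this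
    exact ⟨k, by exact_mod_cast hk⟩
  have hev : ∀ n : Fin 8 → ℤ, Even (∑ i, n i * (n i + 1)) := fun n =>
    Finset.even_sum _ fun i _ => Int.even_mul_succ_self _
  rcases j with ⟨n, m, hm⟩ | ⟨n, m, hm⟩
  · obtain ⟨k, hk⟩ := hev n
    refine ⟨k - m, ?_⟩
    have h1 : ((∑ i, n i * (n i + 1) : ℤ) : ℝ) = ((k + k : ℤ) : ℝ) := by rw [hk]
    have h2 : ((∑ i, n i : ℤ) : ℝ) = ((m + m : ℤ) : ℝ) := by rw [hm]
    push_cast at h1 h2 ⊢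
    simp only [mul_add, Finset.sum_add_distrib, mul_one] at h1
    simp only [dot8, emb]
    linarith
  · obtain ⟨k, hk⟩ := hev n
    refine ⟨k + 1, ?_⟩
    have h1 : ((∑ i, n i * (n i + 1) : ℤ) : ℝ) = ((k + k : ℤ) : ℝ) := by rw [hk]
    push_cast at h1 ⊢
    have h3 : dot8 (emb (.inr ⟨n, m, hm⟩)) (emb (.inr ⟨n, m, hm⟩)) =
        ∑ i, ((n i : ℝ) * (n i + 1) + 1 / 4) :=
      Finset.sum_congr rfl fun i _ => by simp only [emb]; ring
    rw [h3, Finset.sum_add_distrib, h1]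
    norm_num; ring

/-- Half the norm. -/
def nrm (j : EvenVec ⊕ EvenVec) : ℕ := (exists_norm_s17 j).choose

theorem nrm_spec (j : EvenVec ⊕ EvenVec) : dot8 (emb j) (emb j) = 2 * (nrm j : ℝ) :=
  (exists_norm_s17 j).choose_spec

theorem hasSum_theta {τ : ℂ} (hτ : 0 < τ.im) :
    HasSum (fun j => cexp (2 * π * I * τ) ^ nrm j) (thetaE8 τ) := by
  have hq : ∀ j, cexp (2 * π * I * τ) ^ nrm j =
      cexp (π * I * (dot8 (emb j) (emb j) : ℝ) * τ) := by
    intro j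
    rw [nrm_spec, ← Complex.exp_nat_mul]
    congr 1; push_cast; ring
  simp only [hq]
  have h1 := half_sum 0 hτ
  have h2 := (half_sum (τ / 2) hτ).mul_left (cexp (2 * π * I * τ))
  have h3 : τ / 2 + 1 / 2 = (τ + 1) / 2 := by ring
  rw [h3, theta_odd] at h2
  have h4 : thetaE8 τ = (jacobiTheta₂ 0 τ ^ 8 + jacobiTheta₂ (0 + 1 / 2) τ ^ 8) / 2 +
      cexp (2 * π * I * τ) * ((jacobiTheta₂ (τ / 2) τ ^ 8 + 0 ^ 8) / 2) := by
    rw [thetaE8, thetaB, zero_add]; ring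
  rw [h4]
  refine HasSum.sum ?_ ?_
  · convert! h1 using 1
    ext n
    simp only [Function.comp, emb, dot8]
    congr 1
    push_cast
    simp [sq]
  · convert! h2 using 1
    ext n
    rw [← Complex.exp_add]
    simp only [Function.comp]
    congr 1
    have h5 : dot8 (emb (.inr n)) (emb (.inr n)) = ∑ i, ((n.1 i : ℝ) ^ 2 + n.1 i + 1 / 4) :=
      Finset.sum_congr rfl fun i _ => by simp only [emb]; ring
    rw [h5, Finset.sum_add_distrib, Finset.sum_add_distrib]
    push_cast
    simp only [Finset.sum_const, Finset.card_univ, Fintype.card_fin]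
    simp
    ring

open UpperHalfPlane hiding I
open ModularForm MatrixGroups EisensteinSeries

theorem slash_S : (fun z : ℍ => thetaE8 z) ∣[(4 : ℤ)] ModularGroup.S = fun z : ℍ => thetaE8 z := by
  ext z
  rw [SL_slash_apply, ModularGroup.denom_S, modular_S_smul]
  have h := thetaE8_S (ne_zero z)
  have h1 : (-(z : ℂ))⁻¹ = -1 / z := by rw [neg_div, one_div, inv_neg]
  simp only [h1, h]
  have := ne_zero z
  rw [zpow_neg]
  field_simp

theorem slash_T : (fun z : ℍ => thetaE8 z) ∣[(4 : ℤ)] ModularGroup.T = fun z : ℍ => thetaE8 z := by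
  ext z
  rw [SL_slash_apply, ModularGroup.denom_apply, modular_T_smul]
  have h := thetaE8_add_one z
  simp [ModularGroup.T, add_comm _ (z : ℂ), h]

theorem bdd : IsBoundedAtImInfty (fun z : ℍ => thetaE8 z) := by
  rw [isBoundedAtImInfty_iff]
  have hI := (hasSum_theta (τ := I) (by simp)).summable.norm
  refine ⟨∑' j, ‖cexp (2 * π * I * I) ^ nrm j‖, 1, fun z hz => ?_⟩
  have hz' : 0 < (z : ℂ).im := z.2
  rw [← (hasSum_theta hz').tsum_eq]
  refine tsum_of_norm_bounded hI.hasSum fun j => ?_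
  rw [norm_pow, norm_pow]
  refine pow_le_pow_left₀ (norm_nonneg _) ?_ _
  rw [Complex.norm_exp, Complex.norm_exp]
  refine Real.exp_le_exp.mpr ?_
  have hz1 : (1 : ℝ) ≤ (z : ℂ).im := hz
  simp
  nlinarith [Real.pi_pos]

def thetaForm : ModularForm 𝒮ℒ 4 where
  toFun z := thetaE8 z
  slash_action_eq' := fun _ ⟨γ, hγ⟩ ↦ hγ ▸ SlashInvariantForm.slash_action_generators_SL2Z slash_S slash_T γ
  holo' := by
    refine mdifferentiable_iff.mpr fun z hz => ?_
    refine ((differentiableAt_thetaE8 hz).congr_of_eventuallyEq ?_).differentiableWithinAt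
    filter_upwards [isOpen_upperHalfPlaneSet.mem_nhds hz] with w hw
    simp [ofComplex_apply_of_im_pos hw]
  bdd_at_cusps' {c} hc := by
    rw [Subgroup.IsArithmetic.isCusp_iff_isCusp_SL2Z] at hc
    rw [OnePoint.isBoundedAt_iff_forall_SL2Z hc]
    intro γ _
    have := SlashInvariantForm.slash_action_generators_SL2Z slash_S slash_T γ
    exact this.symm ▸ bdd

theorem coeff_theta (m : ℕ) : (qExpansion 1 thetaForm).coeff m = (Nat.card (nrm ⁻¹' {m}) : ℂ) := by
  refine (ModularFormClass.qExpansion_coeff_unique one_pos one_mem_strictPeriods_SL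
    (c := fun m => (Nat.card (nrm ⁻¹' {m}) : ℂ)) (fun τ => ?_) m).symm
  have h := (hasSum_theta τ.2).tsum_fiberwise nrm
  change HasSum _ (thetaE8 τ)
  convert! h using 1
  ext m
  have : ∀ b : nrm ⁻¹' {m}, cexp (2 * π * I * τ) ^ nrm b = cexp (2 * π * I * τ) ^ m :=
    fun b => by rw [show nrm b = m from b.2]
  simp only [this, tsum_const]
  simp [Function.Periodic.qParam]

theorem coeff_card (m : ℕ) : Nat.card (nrm ⁻¹' {m}) =
    Set.ncard {v : Fin 8 → ℝ | inE8 v ∧ dot8 v v = 2 * (m : ℝ)} := by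
  have : {v : Fin 8 → ℝ | inE8 v ∧ dot8 v v = 2 * (m : ℝ)} = Set.image emb (nrm ⁻¹' {m}) := by
    ext v
    simp only [Set.mem_ofPred_eq, range_emb]
    constructor
    · rintro ⟨⟨j, rfl⟩, h⟩
      refine ⟨j, ?_, rfl⟩
      rw [nrm_spec] at h
      have : (nrm j : ℝ) = m := by linarith
      exact_mod_cast this
    · rintro ⟨j, hj, rfl⟩
      exact ⟨⟨j, rfl⟩, by rw [nrm_spec, show nrm j = m from hj]⟩
  rw [this, Set.ncard_image_of_injective _ emb_injective, Nat.card_coe_set_eq]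

theorem card_zero : Set.ncard {v : Fin 8 → ℝ | inE8 v ∧ dot8 v v = 2 * ((0 : ℕ) : ℝ)} = 1 := by
  rw [Set.ncard_eq_one]
  refine ⟨0, ?_⟩
  ext v
  simp only [Set.mem_ofPred_eq, Set.mem_singleton_iff]
  constructor
  · rintro ⟨-, h⟩
    ext i
    have h' : ∑ i, v i * v i = 0 := by simpa [dot8] using h
    have := (Finset.sum_eq_zero_iff_of_nonneg fun i _ => mul_self_nonneg (v i)).mp h' i (by simp)
    simpa using this
  · rintro rfl
    exact ⟨⟨.inl fun i => ⟨0, by simp⟩, 0, by simp⟩, by simp [dot8]⟩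

theorem card_eq (m : ℕ) (hm : m ≠ 0) :
    Set.ncard {v : Fin 8 → ℝ | inE8 v ∧ dot8 v v = 2 * (m : ℝ)} =
      240 * ∑ d ∈ Nat.divisors m, d ^ 3 := by
  obtain ⟨c, hc⟩ : ∃ c : ℂ, c • E₄ = thetaForm :=
    (finrank_eq_one_iff_of_nonzero' E₄ (E_ne_zero _ ⟨2, rfl⟩)).mp
      (Module.rank_eq_one_iff_finrank_eq_one.mp levelOne_weight_four_rank_one) _
  have hco : ∀ m, (qExpansion 1 thetaForm).coeff m = c * (qExpansion 1 E₄).coeff m := by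
    intro m
    rw [← hc]
    have := ModularForm.qExpansion_smul one_pos one_mem_strictPeriods_SL c E₄
    simp [this]
  have h0 := hco 0
  rw [coeff_theta, coeff_card, card_zero, E_qExpansion_coeff_zero _ ⟨2, rfl⟩] at h0
  have hc1 : c = 1 := by simpa using h0.symm
  have hmm := hco m
  rw [coeff_theta, coeff_card, hc1, E_qExpansion_coeff _ ⟨2, rfl⟩, if_neg hm,
    ArithmeticFunction.sigma_apply] at hmm
  norm_num [show bernoulli 4 = -1 / 30 by rw [bernoulli_eq_bernoulli'_of_ne_one (by norm_num), bernoulli'_four]] at hmm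
  exact_mod_cast hmm

end E8Theta

/-- NS(R) = U ⊕ E8(−1), modelled as triples (a, b, v): the class a·Z + b·F + v
with Z² = −1, F² = 0, Z·F = 1 and v in E8 carrying the negated Euclidean form.
Bisection classes of arithmetic genus g and height g (B·F = 2, B·Z = g,
B² = 2g) biject, via the projection Π to ZF^⊥ ≅ E8(−1), with the vectors of
norm −2(g+2); in particular there are 240·σ₃(g+2) of them. -/
theorem bisections_genus_g_height_g_biject (g : ℕ) :
    Set.BijOn (fun p : ℤ × ℤ × (Fin 8 → ℝ) => p.2.2)
      {p : ℤ × ℤ × (Fin 8 → ℝ) | inE8 p.2.2 ∧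
        p.1 = 2 ∧                                   -- B·F = 2 : bisection
        -p.1 + p.2.1 = (g : ℤ) ∧                    -- height B·Z = g
        ((-p.1 ^ 2 + 2 * p.1 * p.2.1 : ℤ) : ℝ) - dot8 p.2.2 p.2.2
          = 2 * (g : ℝ)}                            -- B² = 2g : genus g
      {v : Fin 8 → ℝ | inE8 v ∧ dot8 v v = 2 * ((g : ℝ) + 2)} ∧
    Set.ncard {v : Fin 8 → ℝ | inE8 v ∧ dot8 v v = 2 * ((g : ℝ) + 2)} =
      240 * ∑ d ∈ Nat.divisors (g + 2), d ^ 3 := by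
  constructor
  · refine ⟨?_, ?_, ?_⟩
    · rintro ⟨a, b, v⟩ ⟨hv, ha, hb, hn⟩
      simp only at hv ha hb hn
      subst ha
      have hb' : b = (g : ℤ) + 2 := by omega
      subst hb'
      refine ⟨hv, ?_⟩
      push_cast at hn
      simp only
      linarith
    · rintro ⟨a, b, v⟩ ⟨_, ha, hb, _⟩ ⟨a2, b2, v2⟩ ⟨_, ha2, hb2, _⟩ h
      simp only at ha hb ha2 hb2 h
      subst ha ha2 h
      have : b = b2 := by omega
      rw [this]
    · rintro v ⟨hv, hn⟩
      refine ⟨(2, (g : ℤ) + 2, v), ⟨hv, rfl, ?_, ?_⟩, rfl⟩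
      · simp only
        omega
      · push_cast
        linarith
  · have h := E8Theta.card_eq (g + 2) (by omega)
    push_cast at h
    exact h
end
end
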